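/- arXiv:1209.3983 — 4 statements merged into one kernel-verified Lean document; each statement's English description precedes it below -/
import Mathlib

section
/- Let 0 < α < 1. For every real φ with |φ| ≤ απ/2, one has cos(φ/α) ≤ (cos φ)^{1/α}. -/
theorem cos_div_le_rpow_cos (α : ℝ) (hα0 : 0 < α) (hα1 : α < 1)
    (φ : ℝ) (hφ : |φ| ≤ α * Real.pi / 2) :
    Real.cos (φ / α) ≤ Real.cos φ ^ (1 / α : ℝ) := by
  obtain ⟨hlo, hhi⟩ := abs_le.mp hφ
  have hmem : φ / α ∈ Set.Icc (-(Real.pi / 2)) (Real.pi / 2) :=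
    ⟨by rw [le_div_iff₀ hα0]; linarith, by rw [div_le_iff₀ hα0]; linarith⟩
  have hzero : (0 : ℝ) ∈ Set.Icc (-(Real.pi / 2)) (Real.pi / 2) := by
    constructor <;> linarith [Real.pi_pos]
  have hcos : 0 ≤ Real.cos (φ / α) := Real.cos_nonneg_of_mem_Icc hmem
  have hconcave := strictConcaveOn_cos_Icc.concaveOn.2 hmem hzero hα0.le
    (sub_nonneg.mpr hα1.le) (add_sub_cancel α 1)
  simp only [smul_eq_mul, mul_zero, add_zero, Real.cos_zero, mul_one,
    mul_div_cancel₀ φ hα0.ne'] at hconcave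
  have hbernoulli := rpow_one_add_le_one_add_mul_self (s := Real.cos (φ / α) - 1)
    (by linarith) hα0.le hα1.le
  rw [add_sub_cancel] at hbernoulli
  have hpow : Real.cos (φ / α) ^ α ≤ Real.cos φ := by linarith
  calc Real.cos (φ / α) = (Real.cos (φ / α) ^ α) ^ (1 / α) := by
        rw [← Real.rpow_mul hcos, mul_one_div_cancel hα0.ne', Real.rpow_one]
    _ ≤ Real.cos φ ^ (1 / α) :=
        Real.rpow_le_rpow (Real.rpow_nonneg hcos α) hpow (one_div_pos.mpr hα0).le
end

section
/- Let 0 < α < 1 and let λ ∈ ℂ, λ ≠ 0, with |arg λ| ≤ απ/2. Then Re(λ^{1/α}) ≤ (Re λ)^{1/α}, where λ^{1/α} is the principal branch and (Re λ)^{1/α} is the real power of the positive real number Re λ. -/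
/-- Weighted AM-GM followed by concavity of the cosine. -/
theorem cos_rpow_le_cos_mul {a x : ℝ} (ha0 : 0 ≤ a) (ha1 : a ≤ 1) (hx : |x| ≤ Real.pi / 2) :
    Real.cos x ^ a ≤ Real.cos (a * x) := by
  obtain ⟨hx1, hx2⟩ := abs_le.mp hx
  have hcos : 0 ≤ Real.cos x := Real.cos_nonneg_of_neg_pi_div_two_le_of_le hx1 hx2
  have hpi := Real.pi_pos
  have amgm := Real.geom_mean_le_arith_mean2_weighted ha0 (sub_nonneg.mpr ha1) hcos zero_le_one
    (add_sub_cancel a 1)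
  have conc := strictConcaveOn_cos_Icc.concaveOn.2 (x := x) (y := 0) ⟨hx1, hx2⟩
    ⟨by linarith, by linarith⟩ ha0 (sub_nonneg.mpr ha1) (add_sub_cancel a 1)
  simp only [Real.one_rpow, mul_one] at amgm
  simp only [smul_eq_mul, mul_zero, add_zero, Real.cos_zero, mul_one] at conc
  exact amgm.trans conc

theorem re_cpow_le_rpow_re (α : ℝ) (hα0 : 0 < α) (hα1 : α < 1)
    (z : ℂ) (hz : z ≠ 0) (harg : |z.arg| ≤ α * Real.pi / 2) :
    (z ^ ((1 : ℂ) / (α : ℂ))).re ≤ z.re ^ (1 / α : ℝ) := by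
  have hx : |z.arg * (1 / α)| ≤ Real.pi / 2 := by
    rw [abs_mul, abs_of_pos (one_div_pos.mpr hα0), mul_one_div, div_le_iff₀ hα0]
    linarith
  have hcos : 0 ≤ Real.cos (z.arg * (1 / α)) :=
    Real.cos_nonneg_of_neg_pi_div_two_le_of_le (abs_le.mp hx).1 (abs_le.mp hx).2
  have key := cos_rpow_le_cos_mul hα0.le hα1.le hx
  have hmul : α * (z.arg * (1 / α)) = z.arg := by field_simp
  rw [hmul] at key
  have hle : Real.cos (z.arg * (1 / α)) ≤ Real.cos z.arg ^ (1 / α) := by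
    have := Real.rpow_le_rpow (Real.rpow_nonneg hcos α) key (one_div_pos.mpr hα0).le
    rwa [← Real.rpow_mul hcos, mul_one_div_cancel hα0.ne', Real.rpow_one] at this
  have hcos' : 0 ≤ Real.cos z.arg := (Real.rpow_nonneg hcos α).trans key
  have hexp : (1 : ℂ) / (α : ℂ) = ((1 / α : ℝ) : ℂ) := by push_cast; rfl
  rw [hexp, Complex.cpow_ofReal_re, ← Complex.norm_mul_cos_arg z,
    Real.mul_rpow (norm_nonneg z) hcos']
  gcongr
end

section
/- Let 0 < α < 1, let m, n be positive integers, and let 𝐏(s) be an m×m matrix whose entries are complex polynomials in s = (s₁, …, s_n) ∈ ℂⁿ of degree at most 1. Suppose there exist constants a, b ≥ 0 such that every root λ_k(s) of det(𝐏(s) − λI) = 0 satisfies Re λ_k(s) ≤ a|τ| + b for all s = σ + iτ ∈ ℂⁿ (σ, τ ∈ ℝⁿ). Then there exists a constant C > 0 such that Λ_α(s) ≤ C ( |τ|^{1/α} + 1 ) for all s = σ + iτ ∈ ℂⁿ. -/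
/-- `specBound α A = max { Re (μ^(1/α)) : μ eigenvalue of A, |arg μ| ≤ απ/2 }`,
taken to be `0` if no eigenvalue satisfies the argument condition. -/
noncomputable def specBound (α : ℝ) {m : ℕ} (A : Matrix (Fin m) (Fin m) ℂ) : ℝ :=
  sSup (insert 0 {x : ℝ | ∃ μ : ℂ, (A - μ • 1).det = 0 ∧
    |μ.arg| ≤ α * Real.pi / 2 ∧ x = (μ ^ ((1 : ℂ)/(α : ℂ))).re})

/-- The Euclidean norm of a vector in `ℝⁿ`. -/
noncomputable def euclNormR {n : ℕ} (τ : Fin n → ℝ) : ℝ :=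
  Real.sqrt (∑ i, τ i ^ 2)

/-- In the sector `|arg μ| ≤ απ/2` with `α ≤ 1`, the real part controls the modulus. -/
theorem norm_mul_cos_le_re {α : ℝ} (hα1 : α ≤ 1) {μ : ℂ}
    (h : |μ.arg| ≤ α * Real.pi / 2) : ‖μ‖ * Real.cos (α * Real.pi / 2) ≤ μ.re := by
  rw [← Complex.norm_mul_cos_arg μ, ← Real.cos_abs μ.arg]
  gcongr
  exact Real.cos_le_cos_of_nonneg_of_le_pi (abs_nonneg _)
    (by nlinarith [Real.pi_pos]) h

theorem specBound_bound_of_re_eigenvalue_bound (α : ℝ) (hα0 : 0 < α) (hα1 : α < 1)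
    (m n : ℕ) (hm : 0 < m) (hn : 0 < n)
    (P : Matrix (Fin m) (Fin m) (MvPolynomial (Fin n) ℂ))
    (hdeg : ∀ i j, (P i j).totalDegree ≤ 1)
    (a b : ℝ) (ha : 0 ≤ a) (hb : 0 ≤ b)
    (hroots : ∀ σ τ : Fin n → ℝ, ∀ z : ℂ,
      ((P.map (MvPolynomial.eval (fun j => (σ j : ℂ) + Complex.I * (τ j : ℂ)))) - z • 1).det = 0 →
        z.re ≤ a * euclNormR τ + b) :
    ∃ C > 0, ∀ σ τ : Fin n → ℝ,
      specBound α (P.map (MvPolynomial.eval (fun j => (σ j : ℂ) + Complex.I * (τ j : ℂ)))) ≤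
        C * (euclNormR τ ^ (1 / α : ℝ) + 1) := by
  have hp1 : 1 ≤ 1 / α := (one_le_div hα0).2 hα1.le
  have hp0 : 0 ≤ 1 / α := zero_le_one.trans hp1
  have hc : 0 < Real.cos (α * Real.pi / 2) := by
    apply Real.cos_pos_of_mem_Ioo
    constructor <;> nlinarith [Real.pi_pos, mul_pos hα0 Real.pi_pos]
  set K : ℝ := (a + b) / Real.cos (α * Real.pi / 2) with hK
  have hK0 : 0 ≤ K := by positivity
  refine ⟨K ^ (1 / α) * 2 ^ (1 / α - 1) + 1, by positivity, fun σ τ => ?_⟩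
  have ht : 0 ≤ euclNormR τ := Real.sqrt_nonneg _
  have hs : 0 ≤ euclNormR τ ^ (1 / α) + 1 := by positivity
  refine csSup_le (Set.insert_nonempty _ _) ?_
  rintro x (rfl | ⟨μ, hdet, harg, rfl⟩)
  · positivity
  have hμ : ‖μ‖ ≤ K * (euclNormR τ + 1) := by
    have hre := norm_mul_cos_le_re hα1.le harg
    have hroot := hroots σ τ μ hdet
    rw [hK, div_mul_eq_mul_div, le_div_iff₀ hc]
    nlinarith [mul_nonneg hb ht]
  calc (μ ^ ((1 : ℂ) / (α : ℂ))).re ≤ ‖μ ^ ((1 : ℂ) / (α : ℂ))‖ := Complex.re_le_norm _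
    _ = ‖μ‖ ^ (1 / α) := by
      rw [← Complex.norm_cpow_real]
      push_cast
      rfl
    _ ≤ (K * (euclNormR τ + 1)) ^ (1 / α) := Real.rpow_le_rpow (norm_nonneg _) hμ hp0
    _ = K ^ (1 / α) * (euclNormR τ + 1) ^ (1 / α) := Real.mul_rpow hK0 (by positivity)
    _ ≤ K ^ (1 / α) * (2 ^ (1 / α - 1) * (euclNormR τ ^ (1 / α) + 1)) := by
      gcongr
      have h := NNReal.rpow_add_le_mul_rpow_add_rpow ⟨euclNormR τ, ht⟩ 1 hp1
      rw [NNReal.one_rpow] at h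
      exact_mod_cast h
    _ ≤ (K ^ (1 / α) * 2 ^ (1 / α - 1) + 1) * (euclNormR τ ^ (1 / α) + 1) := by linarith
end

section
/- Let α > 0 and let k be a nonnegative integer. For every z ∈ ℂ, the k-th complex derivative of the Mittag-Leffler function satisfies d^k/dz^k E_α(z) = k! · E_{α, 1+αk}^{k+1}(z). -/
/-- The Mittag-Leffler function `E_α(z) = ∑_{l=0}^∞ z^l / Γ(αl+1)`. -/
noncomputable def mittagLeffler (α : ℝ) (z : ℂ) : ℂ :=
  ∑' l : ℕ, z ^ l / Complex.Gamma (α * l + 1)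

/-- The three-parameter generalized Mittag-Leffler function
`E_{α,γ}^ρ(z) = ∑_{l=0}^∞ (ρ)_l z^l / (Γ(αl+γ) l!)`. -/
noncomputable def mittagLefflerGen (α γ ρ : ℝ) (z : ℂ) : ℂ :=
  ∑' l : ℕ, ((ascPochhammer ℂ l).eval (ρ : ℂ) * z ^ l) /
    (Complex.Gamma (α * l + γ) * (Nat.factorial l : ℂ))

/-- Lower bound for the Gamma function by restricting its integral to `(R, ∞)`. -/
theorem rpow_mul_exp_neg_le_Gamma_add_one {x R : ℝ} (hx : 0 ≤ x) (hR : 0 ≤ R) :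
    R ^ x * Real.exp (-R) ≤ Real.Gamma (x + 1) := by
  have hint := Real.GammaIntegral_convergent (s := x + 1) (by linarith)
  have hsub : Set.Ioi R ⊆ Set.Ioi 0 := Set.Ioi_subset_Ioi hR
  rw [Real.Gamma_eq_integral (by linarith), ← integral_exp_neg_Ioi R,
    ← MeasureTheory.integral_const_mul]
  calc ∫ t in Set.Ioi R, R ^ x * Real.exp (-t)
      ≤ ∫ t in Set.Ioi R, Real.exp (-t) * t ^ (x + 1 - 1) := by
        refine MeasureTheory.setIntegral_mono_on ((integrableOn_exp_neg_Ioi R).const_mul _)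
          (hint.mono_set hsub) measurableSet_Ioi fun t ht => ?_
        rw [add_sub_cancel_right, mul_comm]
        exact mul_le_mul_of_nonneg_left (Real.rpow_le_rpow hR (le_of_lt ht) hx)
          (Real.exp_pos _).le
    _ ≤ ∫ t in Set.Ioi 0, Real.exp (-t) * t ^ (x + 1 - 1) := by
        refine MeasureTheory.setIntegral_mono_set hint ?_ hsub.eventuallyLE
        filter_upwards [MeasureTheory.ae_restrict_mem measurableSet_Ioi] with t ht
        exact mul_nonneg (Real.exp_pos _).le (Real.rpow_nonneg (le_of_lt ht) _)

/-- The Mittag-Leffler series converges absolutely on every disc. -/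
theorem summable_norm_inv_Gamma_mul_pow {α : ℝ} (hα : 0 < α) {r : ℝ} (hr : 0 ≤ r) :
    Summable fun n : ℕ => ‖(Complex.Gamma (α * n + 1))⁻¹‖ * r ^ n := by
  set R : ℝ := (2 * r + 1) ^ α⁻¹ with hRdef
  have hR : 0 < R := by positivity
  have hRα : R ^ α = 2 * r + 1 := Real.rpow_inv_rpow (by positivity) hα.ne'
  have hq : r / (2 * r + 1) < 1 := by
    rw [div_lt_one (by positivity)]
    linarith
  refine Summable.of_nonneg_of_le (fun n => by positivity) (fun n => ?_)
    ((summable_geometric_of_lt_one (by positivity) hq).mul_left (Real.exp R))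
  have hx : 0 ≤ α * n := by positivity
  have hΓ : 0 < Real.Gamma (α * n + 1) := Real.Gamma_pos_of_pos (by positivity)
  have hnorm : ‖(Complex.Gamma (α * n + 1))⁻¹‖ = (Real.Gamma (α * n + 1))⁻¹ := by
    have hcast : (α * n + 1 : ℂ) = ((α * n + 1 : ℝ) : ℂ) := by push_cast; rfl
    rw [hcast, Complex.Gamma_ofReal, norm_inv, Complex.norm_real, Real.norm_of_nonneg hΓ.le]
  have hle := rpow_mul_exp_neg_le_Gamma_add_one hx hR.le
  rw [Real.rpow_mul hR.le, hRα, Real.rpow_natCast] at hle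
  calc ‖(Complex.Gamma (α * n + 1))⁻¹‖ * r ^ n
      ≤ ((2 * r + 1) ^ n * Real.exp (-R))⁻¹ * r ^ n := by
        rw [hnorm]
        gcongr
    _ = Real.exp R * (r / (2 * r + 1)) ^ n := by
        rw [Real.exp_neg, div_pow, mul_inv, inv_inv]
        ring

theorem summable_norm_succ_mul_pow {a : ℕ → ℂ}
    (ha : ∀ r : ℝ, 0 ≤ r → Summable fun n => ‖a n‖ * r ^ n) {r : ℝ} (hr : 0 ≤ r) :
    Summable fun n : ℕ => ‖((n + 1 : ℕ) : ℂ) * a (n + 1)‖ * r ^ n := by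
  have hs : 0 ≤ 2 * (r + 1) := by positivity
  refine Summable.of_nonneg_of_le (fun n => by positivity) (fun n => ?_)
    ((summable_nat_add_iff 1).mpr (ha _ hs))
  rw [norm_mul, Complex.norm_natCast, mul_comm ((n + 1 : ℕ) : ℝ), mul_assoc, mul_pow]
  have h1 : ((n + 1 : ℕ) : ℝ) ≤ 2 ^ (n + 1) := by exact_mod_cast Nat.lt_two_pow_self.le
  have h2 : r ^ n ≤ (r + 1) ^ (n + 1) :=
    (pow_le_pow_left₀ hr (by linarith) n).trans
      (pow_le_pow_right₀ (by linarith) n.le_succ)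
  gcongr

/-- Termwise differentiation of an everywhere convergent power series. -/
theorem deriv_tsum_mul_pow {a : ℕ → ℂ}
    (ha : ∀ r : ℝ, 0 ≤ r → Summable fun n => ‖a n‖ * r ^ n) (z : ℂ) :
    deriv (fun w => ∑' n, a n * w ^ n) z = ∑' n : ℕ, ((n + 1 : ℕ) : ℂ) * a (n + 1) * z ^ n := by
  have h := Complex.hasSum_deriv_of_summable_norm (F := fun n w => a n * w ^ n)
    (U := Metric.ball 0 (‖z‖ + 1)) (z := z) (ha (‖z‖ + 1) (by positivity))
    (fun n => by fun_prop) Metric.isOpen_ball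
    (fun n w hw => by
      rw [norm_mul, norm_pow]
      have hw' : ‖w‖ ≤ ‖z‖ + 1 := (mem_ball_zero_iff.mp hw).le
      gcongr)
    (by simp)
  rw [← h.tsum_eq, h.summable.tsum_eq_zero_add]
  simp only [deriv_const_mul_field', deriv_pow_field, pow_zero, mul_one, deriv_const, zero_add,
    Nat.add_sub_cancel]
  exact tsum_congr fun n => by ring

theorem iteratedDeriv_tsum_mul_pow (k : ℕ) {a : ℕ → ℂ}
    (ha : ∀ r : ℝ, 0 ≤ r → Summable fun n => ‖a n‖ * r ^ n) (z : ℂ) :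
    iteratedDeriv k (fun w => ∑' n, a n * w ^ n) z =
      ∑' n : ℕ, ((n + k).descFactorial k : ℂ) * a (n + k) * z ^ n := by
  induction k generalizing a with
  | zero => simp
  | succ k ih =>
    rw [iteratedDeriv_succ', funext (deriv_tsum_mul_pow ha),
      ih (a := fun n => ((n + 1 : ℕ) : ℂ) * a (n + 1)) fun r hr =>
        summable_norm_succ_mul_pow ha hr]
    refine tsum_congr fun n => ?_
    rw [← add_assoc n k 1, Nat.succ_descFactorial_succ]
    push_cast
    ring

theorem factorial_mul_ascPochhammer_eval_div (k n : ℕ) :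
    (k.factorial : ℂ) * (ascPochhammer ℂ n).eval (k + 1 : ℂ) / n.factorial =
      (n + k).descFactorial k := by
  have h1 : (ascPochhammer ℂ n).eval (k + 1 : ℂ) = ((k + 1).ascFactorial n : ℂ) := by
    rw [← Nat.cast_succ, ← ascPochhammer_eval_cast, ascPochhammer_nat_eq_ascFactorial]
  have h2 := Nat.factorial_mul_ascFactorial k n
  have h3 := Nat.factorial_mul_descFactorial (Nat.le_add_left k n)
  rw [Nat.add_sub_cancel] at h3
  rw [h1, div_eq_iff (by exact_mod_cast n.factorial_ne_zero),
    mul_comm (Nat.cast (Nat.descFactorial _ _))]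
  exact_mod_cast h2.trans ((congrArg _ (add_comm k n)).trans h3.symm)

theorem iteratedDeriv_mittagLeffler (α : ℝ) (hα : 0 < α) (k : ℕ) (z : ℂ) :
    iteratedDeriv k (mittagLeffler α) z =
      (Nat.factorial k : ℂ) * mittagLefflerGen α (1 + α * k) (k + 1) z := by
  have hML : mittagLeffler α = fun w => ∑' n : ℕ, (Complex.Gamma (α * n + 1))⁻¹ * w ^ n := by
    funext w
    exact tsum_congr fun n => by rw [div_eq_inv_mul]
  rw [hML, iteratedDeriv_tsum_mul_pow k fun r hr => summable_norm_inv_Gamma_mul_pow hα hr,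
    mittagLefflerGen, ← tsum_mul_left]
  refine tsum_congr fun n => ?_
  have hΓ : (α * (n + k : ℕ) + 1 : ℂ) = α * n + (1 + α * k : ℝ) := by
    push_cast
    ring
  rw [← factorial_mul_ascPochhammer_eval_div, hΓ]
  push_cast
  simp only [div_eq_mul_inv, mul_inv]
  ring
end
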